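/- Let n ≥ 3 be an integer. There exists a constant C = C(n) > 0 such that for all δ₁, δ₂ > 0 and all ξ₁, ξ₂ ∈ ℝⁿ with |ξ₁ − ξ₂|² ≥ δ₁δ₂, one has ∫_{ℝⁿ} min(U_{δ₁,ξ₁}(x), U_{δ₂,ξ₂}(x)) · max(U_{δ₁,ξ₁}(x), U_{δ₂,ξ₂}(x))^{(n+2)/(n−2)} dx ≤ C · ( δ₁δ₂ / |ξ₁−ξ₂|² )^{(n−2)/2}. -/

import Mathlib

open MeasureTheory

/-- The standard bubble `U_{δ,ξ}` on `ℝⁿ`. -/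
noncomputable def bubble (n : ℕ) (δ : ℝ) (ξ x : EuclideanSpace ℝ (Fin n)) : ℝ :=
  (Real.sqrt ((n : ℝ) * ((n : ℝ) - 2)) * δ / (δ ^ 2 + ‖x - ξ‖ ^ 2)) ^ (((n : ℝ) - 2) / 2)

/-- The radial weight `t ↦ t ^ (-(2 * m))` truncated to `t < 1`. -/
noncomputable def truncatedPower (m t : ℝ) : ℝ := if t < 1 then t ^ (-(2 * m)) else 0

lemma truncatedPower_nonneg (m : ℝ) {t : ℝ} (ht : 0 ≤ t) : 0 ≤ truncatedPower m t := by
  unfold truncatedPower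
  split_ifs <;> positivity

lemma rpow_kernel_mul_le {m : ℝ} (hm : 0 < m) {δ₁ δ₂ r s₁ s₂ : ℝ} (h₁ : 0 < δ₁) (h₂ : 0 < δ₂)
    (hr : 0 < r) (hs₂ : 0 < s₂) (hs : s₂ < r → r ≤ s₁) :
    (δ₁ / (δ₁ ^ 2 + s₁ ^ 2)) ^ (m + 2) * (δ₂ / (δ₂ ^ 2 + s₂ ^ 2)) ^ m ≤
      (δ₁ * δ₂ / r ^ 2) ^ m *
        ((δ₁ ^ (2 * m + 2))⁻¹ * (1 + (s₁ / δ₁) ^ 2) ^ (-(m + 2)) +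
          (r ^ (2 * m + 2))⁻¹ * truncatedPower m (s₂ / r)) := by
  have hD : 0 < δ₁ ^ 2 + s₁ ^ 2 := by positivity
  rcases lt_or_ge s₂ r with h | h
  · have hrs := hs h
    have hrs2 : r ^ 2 ≤ δ₁ ^ 2 + s₁ ^ 2 := by nlinarith
    have e1 : (δ₁ / (δ₁ ^ 2 + s₁ ^ 2)) ^ (m + 2) ≤ (δ₁ / r ^ 2) ^ m * (1 / r ^ 2) := by
      rw [Real.rpow_add (by positivity), Real.rpow_two]
      gcongr
      calc (δ₁ / (δ₁ ^ 2 + s₁ ^ 2)) ^ 2 = (δ₁ ^ 2 / (δ₁ ^ 2 + s₁ ^ 2)) / (δ₁ ^ 2 + s₁ ^ 2) := by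
            field_simp
        _ ≤ 1 / r ^ 2 := by
            gcongr
            rw [div_le_one hD]; nlinarith
    have e2 : (δ₂ / (δ₂ ^ 2 + s₂ ^ 2)) ^ m ≤ (δ₂ / s₂ ^ 2) ^ m := by
      gcongr; nlinarith
    have e3 : truncatedPower m (s₂ / r) = (r ^ 2 / s₂ ^ 2) ^ m := by
      rw [truncatedPower, if_pos ((div_lt_one hr).2 h), Real.rpow_neg (by positivity),
        Real.rpow_mul (by positivity), Real.rpow_two, ← Real.inv_rpow (by positivity)]
      congr 1; field_simp
    have e4 : (r ^ (2 * m + 2))⁻¹ = (1 / r ^ 2) ^ m * (1 / r ^ 2) := by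
      rw [Real.rpow_add hr, Real.rpow_mul hr.le, Real.rpow_two, one_div,
        Real.inv_rpow (by positivity), mul_inv]
    calc _ ≤ ((δ₁ / r ^ 2) ^ m * (1 / r ^ 2)) * (δ₂ / s₂ ^ 2) ^ m := by gcongr
      _ = (δ₁ * δ₂ / r ^ 2) ^ m * ((r ^ (2 * m + 2))⁻¹ * truncatedPower m (s₂ / r)) := by
          rw [e3, e4, mul_right_comm, ← Real.mul_rpow (by positivity) (by positivity),
            mul_right_comm ((1 / r ^ 2) ^ m), ← mul_assoc,
            ← Real.mul_rpow (by positivity) (by positivity),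
            ← Real.mul_rpow (by positivity) (by positivity)]
          congr 2; field_simp
      _ ≤ _ := by
          gcongr
          exact le_add_of_nonneg_left (by positivity)
  · have e2 : (δ₂ / (δ₂ ^ 2 + s₂ ^ 2)) ^ m ≤ (δ₂ / r ^ 2) ^ m := by
      gcongr; nlinarith
    have e1 : (δ₁ / (δ₁ ^ 2 + s₁ ^ 2)) ^ (m + 2) =
        δ₁ ^ m * ((δ₁ ^ (2 * m + 2))⁻¹ * (1 + (s₁ / δ₁) ^ 2) ^ (-(m + 2))) := by
      have : δ₁ / (δ₁ ^ 2 + s₁ ^ 2) = δ₁⁻¹ * (1 + (s₁ / δ₁) ^ 2)⁻¹ := by field_simp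
      rw [this, Real.mul_rpow (by positivity) (by positivity), Real.inv_rpow (by positivity),
        Real.inv_rpow (by positivity), Real.rpow_neg (by positivity), ← mul_assoc,
        ← Real.rpow_neg h₁.le, ← Real.rpow_neg h₁.le, ← Real.rpow_add h₁]
      congr 2; ring
    calc _ ≤ (δ₁ ^ m * ((δ₁ ^ (2 * m + 2))⁻¹ * (1 + (s₁ / δ₁) ^ 2) ^ (-(m + 2)))) *
          (δ₂ / r ^ 2) ^ m := by rw [e1]; gcongr
      _ = (δ₁ * δ₂ / r ^ 2) ^ m *
          ((δ₁ ^ (2 * m + 2))⁻¹ * (1 + (s₁ / δ₁) ^ 2) ^ (-(m + 2))) := by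
          rw [mul_div_assoc, Real.mul_rpow (by positivity) (by positivity)]; ring
      _ ≤ _ := by
          gcongr
          refine le_add_of_nonneg_right (mul_nonneg (by positivity) ?_)
          exact truncatedPower_nonneg m (by positivity)

lemma integrable_truncatedPower_norm {n : ℕ} (hn : 3 ≤ n) :
    Integrable fun y : EuclideanSpace ℝ (Fin n) ↦ truncatedPower (((n : ℝ) - 2) / 2) ‖y‖ := by
  have : Nonempty (Fin n) := ⟨⟨0, by omega⟩⟩
  rw [integrable_fun_norm_addHaar volume (f := truncatedPower (((n : ℝ) - 2) / 2))]
  have h : IntegrableOn (fun t : ℝ ↦ t) (Set.Ioo 0 1) :=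
    (continuous_id.integrableOn_Icc (a := (0 : ℝ)) (b := 1)).mono_set Set.Ioo_subset_Icc_self
  have h' := (integrable_indicator_iff measurableSet_Ioo).2 h
  refine h'.integrableOn.congr_fun (fun t ht ↦ ?_) measurableSet_Ioi
  have ht : 0 < t := ht
  by_cases h1 : t < 1
  · rw [Set.indicator_of_mem (Set.mem_Ioo.2 ⟨ht, h1⟩)]
    simp only [truncatedPower, if_pos h1, finrank_euclideanSpace, Fintype.card_fin, smul_eq_mul]
    rw [← Real.rpow_natCast, ← Real.rpow_add ht, Nat.cast_sub (by omega)]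
    convert (Real.rpow_one t).symm using 2
    push_cast; ring
  · rw [Set.indicator_of_notMem fun h ↦ h1 h.2]
    simp [truncatedPower, h1]

lemma integrable_rescaled {n : ℕ} {f : EuclideanSpace ℝ (Fin n) → ℝ} (hf : Integrable f)
    {δ : ℝ} (hδ : 0 < δ) (ξ : EuclideanSpace ℝ (Fin n)) :
    Integrable fun x ↦ (δ ^ n)⁻¹ * f (δ⁻¹ • (x - ξ)) :=
  ((hf.comp_smul (inv_ne_zero hδ.ne')).comp_sub_right ξ).const_mul _

lemma integral_rescaled {n : ℕ} (f : EuclideanSpace ℝ (Fin n) → ℝ)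
    {δ : ℝ} (hδ : 0 < δ) (ξ : EuclideanSpace ℝ (Fin n)) :
    ∫ x, (δ ^ n)⁻¹ * f (δ⁻¹ • (x - ξ)) = ∫ x, f x := by
  rw [integral_const_mul, integral_sub_right_eq_self (fun x ↦ f (δ⁻¹ • x)) ξ,
    Measure.integral_comp_inv_smul_of_nonneg _ _ hδ.le]
  simp [hδ.ne']

lemma min_mul_max_rpow_le {a b : ℝ} (ha : 0 ≤ a) (hb : 0 ≤ b) (p : ℝ) :
    min a b * max a b ^ p ≤ a ^ p * b + b ^ p * a := by
  rcases le_total a b with h | h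
  · rw [min_eq_left h, max_eq_right h, mul_comm]
    exact le_add_of_nonneg_left (by positivity)
  · rw [min_eq_right h, max_eq_left h, mul_comm]
    exact le_add_of_nonneg_right (by positivity)

lemma bubble_nonneg {n : ℕ} {δ : ℝ} (hδ : 0 < δ) (ξ x : EuclideanSpace ℝ (Fin n)) :
    0 ≤ bubble n δ ξ x := by
  unfold bubble; positivity

lemma bubble_rpow_mul_bubble {n : ℕ} (hn : 3 ≤ n) {δ₁ δ₂ : ℝ} (h₁ : 0 < δ₁) (h₂ : 0 < δ₂)
    (ξ₁ ξ₂ x : EuclideanSpace ℝ (Fin n)) :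
    bubble n δ₁ ξ₁ x ^ (((n : ℝ) + 2) / ((n : ℝ) - 2)) * bubble n δ₂ ξ₂ x =
      √((n : ℝ) * ((n : ℝ) - 2)) ^ n *
        ((δ₁ / (δ₁ ^ 2 + ‖x - ξ₁‖ ^ 2)) ^ (((n : ℝ) - 2) / 2 + 2) *
          (δ₂ / (δ₂ ^ 2 + ‖x - ξ₂‖ ^ 2)) ^ (((n : ℝ) - 2) / 2)) := by
  have hn' : (3 : ℝ) ≤ n := by exact_mod_cast hn
  have hpos : 0 < √((n : ℝ) * ((n : ℝ) - 2)) :=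
    Real.sqrt_pos.2 (mul_pos (by linarith) (by linarith))
  set c := √((n : ℝ) * ((n : ℝ) - 2)) with hc
  have hexp : ((n : ℝ) - 2) / 2 * (((n : ℝ) + 2) / ((n : ℝ) - 2)) = ((n : ℝ) - 2) / 2 + 2 := by
    have : (n : ℝ) - 2 ≠ 0 := by linarith
    field_simp; ring
  have hcn : c ^ n = c ^ (((n : ℝ) - 2) / 2 + 2) * c ^ (((n : ℝ) - 2) / 2) := by
    rw [← Real.rpow_add hpos, ← Real.rpow_natCast]
    congr 1; ring
  unfold bubble
  rw [← hc, ← Real.rpow_mul (by positivity), hexp, mul_div_assoc, mul_div_assoc,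
    Real.mul_rpow hpos.le (by positivity), Real.mul_rpow hpos.le (by positivity), hcn]
  ring

/-- The integrable function dominating `U_{δ₁,ξ₁} ^ (2* - 1) * U_{δ₂,ξ₂}`, up to constants. -/
noncomputable def bubbleMajorant (n : ℕ) (δ r : ℝ) (ξ₁ ξ₂ x : EuclideanSpace ℝ (Fin n)) : ℝ :=
  (δ ^ n)⁻¹ * (1 + ‖δ⁻¹ • (x - ξ₁)‖ ^ 2) ^ (-((n : ℝ) + 2) / 2) +
    (r ^ n)⁻¹ * truncatedPower (((n : ℝ) - 2) / 2) ‖r⁻¹ • (x - ξ₂)‖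

lemma integrable_one_add_norm_sq_rpow (n : ℕ) :
    Integrable fun y : EuclideanSpace ℝ (Fin n) ↦ (1 + ‖y‖ ^ 2) ^ (-((n : ℝ) + 2) / 2) :=
  integrable_rpow_neg_one_add_norm_sq (by simp)

lemma integrable_bubbleMajorant {n : ℕ} (hn : 3 ≤ n) {δ r : ℝ} (hδ : 0 < δ) (hr : 0 < r)
    (ξ₁ ξ₂ : EuclideanSpace ℝ (Fin n)) : Integrable (bubbleMajorant n δ r ξ₁ ξ₂) :=
  (integrable_rescaled (integrable_one_add_norm_sq_rpow n) hδ ξ₁).add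
    (integrable_rescaled (integrable_truncatedPower_norm hn) hr ξ₂)

lemma integral_bubbleMajorant {n : ℕ} (hn : 3 ≤ n) {δ r : ℝ} (hδ : 0 < δ) (hr : 0 < r)
    (ξ₁ ξ₂ : EuclideanSpace ℝ (Fin n)) :
    ∫ x, bubbleMajorant n δ r ξ₁ ξ₂ x =
      (∫ y : EuclideanSpace ℝ (Fin n), (1 + ‖y‖ ^ 2) ^ (-((n : ℝ) + 2) / 2)) +
        ∫ y : EuclideanSpace ℝ (Fin n), truncatedPower (((n : ℝ) - 2) / 2) ‖y‖ := by
  unfold bubbleMajorant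
  rw [integral_add (integrable_rescaled (integrable_one_add_norm_sq_rpow n) hδ ξ₁)
      (integrable_rescaled (integrable_truncatedPower_norm hn) hr ξ₂),
    integral_rescaled (fun y ↦ (1 + ‖y‖ ^ 2) ^ (-((n : ℝ) + 2) / 2)) hδ,
    integral_rescaled (fun y ↦ truncatedPower (((n : ℝ) - 2) / 2) ‖y‖) hr]

lemma bubble_rpow_mul_bubble_le {n : ℕ} (hn : 3 ≤ n) {δ₁ δ₂ r : ℝ} (h₁ : 0 < δ₁) (h₂ : 0 < δ₂)
    (hr : 0 < r) {ξ₁ ξ₂ x : EuclideanSpace ℝ (Fin n)} (hξ : 2 * r ≤ ‖ξ₁ - ξ₂‖) (hx : x ≠ ξ₂) :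
    bubble n δ₁ ξ₁ x ^ (((n : ℝ) + 2) / ((n : ℝ) - 2)) * bubble n δ₂ ξ₂ x ≤
      √((n : ℝ) * ((n : ℝ) - 2)) ^ n * ((δ₁ * δ₂ / r ^ 2) ^ (((n : ℝ) - 2) / 2) *
        bubbleMajorant n δ₁ r ξ₁ ξ₂ x) := by
  have hn' : (3 : ℝ) ≤ n := by exact_mod_cast hn
  have htri : ‖ξ₁ - ξ₂‖ ≤ ‖x - ξ₁‖ + ‖x - ξ₂‖ := by
    rw [norm_sub_rev x ξ₁]
    exact norm_sub_le_norm_sub_add_norm_sub ξ₁ x ξ₂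
  have hscale : ∀ {δ : ℝ}, 0 < δ → ∀ ξ, ‖δ⁻¹ • (x - ξ)‖ = ‖x - ξ‖ / δ := fun hδ ξ ↦ by
    rw [norm_smul, norm_inv, Real.norm_of_nonneg hδ.le, inv_mul_eq_div]
  have key := rpow_kernel_mul_le (m := ((n : ℝ) - 2) / 2) (by linarith) h₁ h₂ hr
    (s₁ := ‖x - ξ₁‖) (norm_sub_pos_iff.2 hx) (fun h ↦ by linarith)
  rw [bubble_rpow_mul_bubble hn h₁ h₂, bubbleMajorant, hscale h₁, hscale hr]
  have e1 : 2 * (((n : ℝ) - 2) / 2) + 2 = n := by ring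
  have e2 : -(((n : ℝ) - 2) / 2 + 2) = -((n : ℝ) + 2) / 2 := by ring
  rw [e1, e2, Real.rpow_natCast, Real.rpow_natCast] at key
  gcongr

theorem bubble_min_max_interaction_estimate (n : ℕ) (hn : 3 ≤ n) :
    ∃ C : ℝ, 0 < C ∧ ∀ δ₁ δ₂ : ℝ, 0 < δ₁ → 0 < δ₂ →
      ∀ ξ₁ ξ₂ : EuclideanSpace ℝ (Fin n), δ₁ * δ₂ ≤ ‖ξ₁ - ξ₂‖ ^ 2 →
        ∫ x, min (bubble n δ₁ ξ₁ x) (bubble n δ₂ ξ₂ x) *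
            max (bubble n δ₁ ξ₁ x) (bubble n δ₂ ξ₂ x) ^ (((n : ℝ) + 2) / ((n : ℝ) - 2)) ≤
          C * (δ₁ * δ₂ / ‖ξ₁ - ξ₂‖ ^ 2) ^ (((n : ℝ) - 2) / 2) := by
  have : Nonempty (Fin n) := ⟨⟨0, by omega⟩⟩
  set c := √((n : ℝ) * ((n : ℝ) - 2)) with hc
  set m := ((n : ℝ) - 2) / 2 with hm
  set K := (∫ y : EuclideanSpace ℝ (Fin n), (1 + ‖y‖ ^ 2) ^ (-((n : ℝ) + 2) / 2)) +
    ∫ y : EuclideanSpace ℝ (Fin n), truncatedPower m ‖y‖ with hK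
  have hK0 : 0 ≤ K :=
    add_nonneg (integral_nonneg fun y ↦ by positivity)
      (integral_nonneg fun y ↦ truncatedPower_nonneg m (norm_nonneg y))
  refine ⟨c ^ n * 4 ^ m * (2 * K) + 1, by positivity, fun δ₁ δ₂ h₁ h₂ ξ₁ ξ₂ hξ ↦ ?_⟩
  have hd : 0 < ‖ξ₁ - ξ₂‖ := by
    by_contra! h
    have : ‖ξ₁ - ξ₂‖ = 0 := le_antisymm h (norm_nonneg _)
    rw [this] at hξ
    nlinarith [mul_pos h₁ h₂]
  set r := ‖ξ₁ - ξ₂‖ / 2 with hrdef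
  have hr : 0 < r := half_pos hd
  have hq : (δ₁ * δ₂ / r ^ 2) ^ m = 4 ^ m * (δ₁ * δ₂ / ‖ξ₁ - ξ₂‖ ^ 2) ^ m := by
    rw [← Real.mul_rpow (by norm_num) (by positivity), hrdef]
    congr 1; field_simp; norm_num
  have i₁ := integrable_bubbleMajorant hn h₁ hr ξ₁ ξ₂
  have i₂ := integrable_bubbleMajorant hn h₂ hr ξ₂ ξ₁
  calc _ ≤ ∫ x, c ^ n * (δ₁ * δ₂ / r ^ 2) ^ m *
        (bubbleMajorant n δ₁ r ξ₁ ξ₂ x + bubbleMajorant n δ₂ r ξ₂ ξ₁ x) := by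
        refine integral_mono_of_nonneg (.of_forall fun x ↦ ?_) ((i₁.add i₂).const_mul _) ?_
        · have b₁ := bubble_nonneg h₁ ξ₁ x
          have b₂ := bubble_nonneg h₂ ξ₂ x
          exact mul_nonneg (le_min b₁ b₂) (Real.rpow_nonneg (le_max_of_le_left b₁) _)
        · filter_upwards [Measure.ae_ne volume ξ₁, Measure.ae_ne volume ξ₂] with x hx₁ hx₂
          have k₁ := bubble_rpow_mul_bubble_le hn h₁ h₂ hr (x := x) (ξ₁ := ξ₁)
            (by rw [hrdef]; linarith) hx₂
          have k₂ := bubble_rpow_mul_bubble_le hn h₂ h₁ hr (x := x) (ξ₁ := ξ₂)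
            (by rw [hrdef, norm_sub_rev]; linarith) hx₁
          rw [mul_comm δ₂ δ₁] at k₂
          refine (min_mul_max_rpow_le (bubble_nonneg h₁ ξ₁ x) (bubble_nonneg h₂ ξ₂ x) _).trans
            ((add_le_add k₁ k₂).trans_eq ?_)
          ring
    _ = c ^ n * 4 ^ m * (2 * K) * (δ₁ * δ₂ / ‖ξ₁ - ξ₂‖ ^ 2) ^ m := by
        rw [integral_const_mul, integral_add i₁ i₂, integral_bubbleMajorant hn h₁ hr,
          integral_bubbleMajorant hn h₂ hr, ← hK, hq]
        ring
    _ ≤ _ := by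
        gcongr
        linarith
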